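/- arXiv:2511.16406 — 2 statements merged into one kernel-verified Lean document; each statement's English description precedes it below -/
import Mathlib

section
/- Let μ ∈ (−1/2, 1/2), let K_p, K_d, K_i ∈ ℝ, and let h be a d_μ-homogeneous norm on ℝ². Let g_μ : ℝ³ → ℝ³ be the hPID closed-loop vector field and d̃_μ(s) = diag(e^{(1−μ)s}, e^{s}, e^{(1+μ)s}). Then g_μ(d̃_μ(s)x) = e^{μ s} d̃_μ(s) g_μ(x) for all s ∈ ℝ and all x ∈ ℝ³; i.e., g_μ is d̃_μ-homogeneous of degree μ. -/
open Matrix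

/-- A `d`-homogeneous norm on `ℝ²` (for a family of matrices `d(s)`). -/
def IsHomNorm2 (d : ℝ → Matrix (Fin 2) (Fin 2) ℝ)
    (h : (Fin 2 → ℝ) → ℝ) : Prop :=
  Continuous h ∧ (∀ ξ, 0 ≤ h ξ) ∧ h 0 = 0 ∧ (∀ ξ, ξ ≠ 0 → 0 < h ξ) ∧
  (∀ (ξ : Fin 2 → ℝ) (s : ℝ), h ((d s) *ᵥ ξ) = Real.exp s * h ξ) ∧
  (∀ (ξ : Fin 2 → ℝ) (s : ℝ), h (-((d s) *ᵥ ξ)) = Real.exp s * h ξ)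

/-- The dilation `d_μ(s) = diag(e^{(1−μ)s}, e^{s})` on `ℝ²`. -/
noncomputable def dmu (μ s : ℝ) : Matrix (Fin 2) (Fin 2) ℝ :=
  Matrix.diagonal ![Real.exp ((1 - μ) * s), Real.exp s]

/-- The dilation `d̃_μ(s) = diag(e^{(1−μ)s}, e^{s}, e^{(1+μ)s})` on `ℝ³`. -/
noncomputable def dmu3 (μ s : ℝ) : Matrix (Fin 3) (Fin 3) ℝ :=
  Matrix.diagonal ![Real.exp ((1 - μ) * s), Real.exp s, Real.exp ((1 + μ) * s)]

/-- The hPID closed-loop vector field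
`g_μ(x) = (x₂, K_p h(ξ)^{2μ} x₁ + K_d h(ξ)^{μ} x₂ + x₃, K_i h(ξ)^{3μ} x₁)`,
`ξ = (x₁, x₂)`.  (Each term containing a power of `h(ξ)` vanishes when `ξ = 0`
since it carries a factor `x₁` or `x₂`.) -/
noncomputable def gmu (Kp Kd Ki μ : ℝ) (h : (Fin 2 → ℝ) → ℝ)
    (x : Fin 3 → ℝ) : Fin 3 → ℝ :=
  ![x 1,
    Kp * h ![x 0, x 1] ^ (2 * μ) * x 0 + Kd * h ![x 0, x 1] ^ μ * x 1 + x 2,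
    Ki * h ![x 0, x 1] ^ (3 * μ) * x 0]

/-- the hPID closed-loop vector field `g_μ` is `d̃_μ`-homogeneous of
degree `μ`: `g_μ(d̃_μ(s)x) = e^{μs} d̃_μ(s) g_μ(x)`. -/
theorem gmu_homogeneous (μ : ℝ) (hμ : μ ∈ Set.Ioo (-(1:ℝ)/2) (1/2))
    (Kp Kd Ki : ℝ) (h : (Fin 2 → ℝ) → ℝ)
    (hh : IsHomNorm2 (dmu μ) h) :
    ∀ (s : ℝ) (x : Fin 3 → ℝ),
      gmu Kp Kd Ki μ h ((dmu3 μ s) *ᵥ x) =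
        Real.exp (μ * s) • ((dmu3 μ s) *ᵥ gmu Kp Kd Ki μ h x) := by
  obtain ⟨-, hnonneg, -, -, hdil, -⟩ := hh
  intro s x
  have hscale : h ![Real.exp ((1 - μ) * s) * x 0, Real.exp s * x 1] =
      Real.exp s * h ![x 0, x 1] := by
    rw [← hdil]
    congr 1
    ext i
    fin_cases i <;> simp [dmu, mulVec_diagonal]
  have hpow (a : ℝ) : (Real.exp s * h ![x 0, x 1]) ^ a =
      Real.exp (s * a) * h ![x 0, x 1] ^ a := by
    rw [Real.mul_rpow (Real.exp_pos s).le (hnonneg _), ← Real.exp_mul]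
  have hexp_fst : Real.exp s = Real.exp (μ * s) * Real.exp ((1 - μ) * s) := by
    rw [← Real.exp_add]; ring_nf
  have hexp_prop : Real.exp (s * (2 * μ)) * Real.exp ((1 - μ) * s) =
      Real.exp (μ * s) * Real.exp s := by
    simp only [← Real.exp_add]; ring_nf
  have hexp_int : Real.exp ((1 + μ) * s) = Real.exp (μ * s) * Real.exp s := by
    rw [← Real.exp_add]; ring_nf
  have hexp_thd : Real.exp (s * (3 * μ)) * Real.exp ((1 - μ) * s) =
      Real.exp (μ * s) * Real.exp ((1 + μ) * s) := by
    simp only [← Real.exp_add]; ring_nf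
  ext i
  fin_cases i
  · simp only [gmu, dmu3, mulVec_diagonal, Pi.smul_apply, smul_eq_mul, Fin.zero_eta,
      cons_val_zero, cons_val_one]
    linear_combination x 1 * hexp_fst
  · simp only [gmu, dmu3, mulVec_diagonal, Pi.smul_apply, smul_eq_mul, Fin.mk_one,
      cons_val_zero, cons_val_one, cons_val, hscale, hpow, mul_comm s μ]
    linear_combination Kp * h ![x 0, x 1] ^ (2 * μ) * x 0 * hexp_prop + x 2 * hexp_int
  · simp only [gmu, dmu3, mulVec_diagonal, Pi.smul_apply, smul_eq_mul, Fin.reduceFinMk,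
      cons_val_zero, cons_val_one, cons_val, hscale, hpow]
    linear_combination Ki * h ![x 0, x 1] ^ (3 * μ) * x 0 * hexp_thd
end

section
/- (Theorem 1.) Let K_p, K_d, K_i ∈ ℝ be such that the matrix A with rows (0,1,0), (K_p, K_d, 1), (K_i, 0, 0) is Hurwitz (equivalently, the double integrator with the linear PID is globally asymptotically stable). Let H : (−1/2,1/2) × ℝ² → [0,∞) be jointly continuous and such that for each μ ∈ (−1/2,1/2) the function H(μ, ·) is a d_μ-homogeneous norm on ℝ². Then there exists ε ∈ (0, 1/2] such that for every μ with |μ| < ε, the closed-loop system ẋ = g_μ(x) on ℝ³ (with h = H(μ,·)) is globally asymptotically stable; that is: (i) for every r > 0 there exists δ > 0 such that every differentiable x : [0,∞) → ℝ³ with x′(t) = g_μ(x(t)) for all t ≥ 0 and ‖x(0)‖ ≤ δ satisfies ‖x(t)‖ ≤ r for all t ≥ 0; and (ii) every differentiable x : [0,∞) → ℝ³ with x′(t) = g_μ(x(t)) for all t ≥ 0 satisfies x(t) → 0 as t → ∞. -/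
open Matrix Filter

/-- Euclidean norm on `Fin 3 → ℝ`. -/
noncomputable def eucNorm3 (x : Fin 3 → ℝ) : ℝ :=
  Real.sqrt (∑ i, (x i) ^ 2)

/-- Routh-Hurwitz data of a monic real cubic. -/
lemma cubic_factor (a b c : ℝ)
    (hroots : ∀ z : ℂ, z ^ 3 + a * z ^ 2 + b * z + c = 0 → z.re < 0) :
    ∃ p q r : ℝ, 0 < p ∧ 0 < q ∧ 0 < r ∧ a = p + q ∧ b = p * q + r ∧ c = p * r := by
  obtain ⟨u, hu⟩ : ∃ u : ℝ, u ^ 3 + a * u ^ 2 + b * u + c = 0 := by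
    set N : ℝ := 1 + |a| + |b| + |c| with hN
    have ha := neg_abs_le a
    have hb := neg_abs_le b
    have hc := neg_abs_le c
    have ha' := le_abs_self a
    have hb' := le_abs_self b
    have hc' := le_abs_self c
    have ha0 := abs_nonneg a
    have hb0 := abs_nonneg b
    have hc0 := abs_nonneg c
    have hN1 : 1 ≤ N := by linarith
    have hNN : N ≤ N ^ 2 := by nlinarith
    have hN2 : 1 ≤ N ^ 2 := by linarith
    have key : N ^ 3 = N ^ 2 + |a| * N ^ 2 + |b| * N ^ 2 + |c| * N ^ 2 := by
      rw [hN]; ring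
    have e1 : |a * N ^ 2| ≤ |a| * N ^ 2 := by rw [abs_mul, abs_of_nonneg (sq_nonneg N)]
    have e2 : |b * N| ≤ |b| * N ^ 2 := by
      rw [abs_mul, abs_of_nonneg (by linarith : 0 ≤ N)]; gcongr
    have e3 : |c| ≤ |c| * N ^ 2 := le_mul_of_one_le_right hc0 hN2
    have hcont : ContinuousOn (fun u : ℝ => u ^ 3 + a * u ^ 2 + b * u + c)
        (Set.Icc (-N) N) := by fun_prop
    have h0 := intermediate_value_Icc (by linarith : -N ≤ N) hcont
    have hmem : (0 : ℝ) ∈ Set.Icc ((-N) ^ 3 + a * (-N) ^ 2 + b * (-N) + c)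
        (N ^ 3 + a * N ^ 2 + b * N + c) := by
      rw [abs_le] at e1 e2
      constructor <;> nlinarith
    obtain ⟨u, -, hu⟩ := h0 hmem
    exact ⟨u, hu⟩
  have hune := hroots u (by exact_mod_cast hu)
  simp only [Complex.ofReal_re] at hune
  set q : ℝ := a + u with hq
  set r : ℝ := b + q * u with hr
  have hfac : ∀ z : ℂ, z ^ 2 + q * z + r = 0 → z.re < 0 := by
    intro z hz
    apply hroots
    have hu' : (u : ℂ) ^ 3 + a * u ^ 2 + b * u + c = 0 := by exact_mod_cast hu
    have : z ^ 3 + a * z ^ 2 + b * z + c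
        = (z - u) * (z ^ 2 + q * z + r) + ((u : ℂ) ^ 3 + a * u ^ 2 + b * u + c) := by
      rw [hr, hq]; push_cast; ring
    rw [this, hz, hu']; ring
  have hqpos : 0 < q := by
    obtain ⟨w, hw⟩ := IsAlgClosed.exists_pow_nat_eq ((q : ℂ) ^ 2 - 4 * r) (n := 2) (by norm_num)
    have h1 := hfac ((-q + w) / 2) (by linear_combination hw / 4)
    have h2 := hfac ((-q - w) / 2) (by linear_combination hw / 4)
    have e1 : ((-(q : ℂ) + w) / 2).re = (-q + w.re) / 2 := by
      simp
    have e2 : ((-(q : ℂ) - w) / 2).re = (-q - w.re) / 2 := by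
      simp
    rw [e1] at h1
    rw [e2] at h2
    linarith
  have hrpos : 0 < r := by
    by_contra hneg
    have hd : 0 ≤ q ^ 2 - 4 * r := by nlinarith
    have hs := Real.sq_sqrt hd
    set w := Real.sqrt (q ^ 2 - 4 * r)
    have hz : ((-q + w) / 2) ^ 2 + q * ((-q + w) / 2) + r = 0 := by linear_combination hs / 4
    have h1 := hfac (((-q + w) / 2 : ℝ) : ℂ) (by exact_mod_cast hz)
    rw [Complex.ofReal_re] at h1
    have : q ≤ w := Real.le_sqrt_of_sq_le (by linarith)
    linarith
  refine ⟨-u, q, r, by linarith, hqpos, hrpos, by ring, by ring, ?_⟩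
  rw [hr, hq]
  linear_combination hu

/-- Quadratic Lyapunov function of the linear PID closed loop. -/
lemma exists_lyapunov_matrix (Kp Kd Ki : ℝ)
    (hHurwitz : ∀ z ∈ spectrum ℂ ((Matrix.of ![![0, 1, 0], ![Kp, Kd, 1], ![Ki, 0, 0]] :
      Matrix (Fin 3) (Fin 3) ℝ).map (algebraMap ℝ ℂ)), z.re < 0) :
    ∃ P : Matrix (Fin 3) (Fin 3) ℝ, P.IsSymm ∧ (∀ x : Fin 3 → ℝ, x ≠ 0 → 0 < x ⬝ᵥ (P *ᵥ x)) ∧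
      ∀ x : Fin 3 → ℝ, x ≠ 0 → x ⬝ᵥ (P *ᵥ ![x 1, Kp * x 0 + Kd * x 1 + x 2, Ki * x 0]) < 0 := by
  obtain ⟨p, q, r, hp, hq, hr, ha, hb, hc⟩ := cubic_factor (-Kd) (-Kp) (-Ki) (by
    intro z hz
    apply hHurwitz
    rw [Matrix.mem_spectrum_iff_isRoot_charpoly, Polynomial.IsRoot, Matrix.eval_charpoly,
      Matrix.det_fin_three]
    simp [Matrix.scalar_apply]
    push_cast at hz
    linear_combination hz)
  obtain rfl : Kd = -(p + q) := by linarith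
  obtain rfl : Kp = -(p * q + r) := by linarith
  obtain rfl : Ki = -(p * r) := by linarith
  set M : ℝ := (2 / q + q / (2 * r)) / p with hM
  have hMpos : 0 < M := by positivity
  have hMp : M * p = 2 / q + q / (2 * r) := by rw [hM]; field_simp
  refine ⟨Matrix.of ![![r + q ^ 2 / 2 + M * (p * q) ^ 2, q / 2 + M * p ^ 2 * q, -(M * p * q)],
    ![q / 2 + M * p ^ 2 * q, 1 + M * p ^ 2, -(M * p)], ![-(M * p * q), -(M * p), M]], ?_, ?_, ?_⟩
  · ext i j
    fin_cases i <;> fin_cases j <;> rfl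
  · intro x hx
    have hV : 0 < (r + q ^ 2 / 4) * x 0 ^ 2 + (x 1 + q / 2 * x 0) ^ 2
        + M * (x 2 - p * q * x 0 - p * x 1) ^ 2 := by
      by_contra hcon
      have h1 : 0 ≤ (r + q ^ 2 / 4) * x 0 ^ 2 := by positivity
      have h2 := sq_nonneg (x 1 + q / 2 * x 0)
      have h3 : 0 ≤ M * (x 2 - p * q * x 0 - p * x 1) ^ 2 := by positivity
      have e1 : (r + q ^ 2 / 4) * x 0 ^ 2 = 0 := by linarith
      have e2 : (x 1 + q / 2 * x 0) ^ 2 = 0 := by linarith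
      have e3 : M * (x 2 - p * q * x 0 - p * x 1) ^ 2 = 0 := by linarith
      have f1 : x 0 = 0 := by
        have : r + q ^ 2 / 4 ≠ 0 := by positivity
        simpa [this] using e1
      have f2 : x 1 = 0 := by simpa [f1] using e2
      have f3 : x 2 = 0 := by simpa [f1, f2, hMpos.ne'] using e3
      apply hx
      ext i
      fin_cases i <;> simp [f1, f2, f3]
    convert hV using 1
    simp [dotProduct, Matrix.mulVec, Fin.sum_univ_three]
    ring
  · intro x hx
    set v := x 2 - p * q * x 0 - p * x 1 with hv
    have hV : 0 < q / 2 * (x 1 - 2 / q * v) ^ 2 + q * r / 2 * (x 0 - v / r) ^ 2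
        + q / 2 * x 1 ^ 2 + q * r / 2 * x 0 ^ 2 + M * p * v ^ 2 := by
      by_contra hcon
      have h1 : 0 ≤ q / 2 * (x 1 - 2 / q * v) ^ 2 := by positivity
      have h2 : 0 ≤ q * r / 2 * (x 0 - v / r) ^ 2 := by positivity
      have h3 : 0 ≤ q / 2 * x 1 ^ 2 := by positivity
      have h4 : 0 ≤ q * r / 2 * x 0 ^ 2 := by positivity
      have h5 : 0 ≤ M * p * v ^ 2 := by positivity
      have e1 : q / 2 * x 1 ^ 2 = 0 := by linarith
      have e2 : q * r / 2 * x 0 ^ 2 = 0 := by linarith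
      have e3 : M * p * v ^ 2 = 0 := by linarith
      have f1 : x 0 = 0 := by simpa [hq.ne', hr.ne'] using e2
      have f2 : x 1 = 0 := by simpa [hq.ne'] using e1
      have f3 : x 2 = 0 := by simpa [hv, f1, f2, hMpos.ne', hp.ne'] using e3
      apply hx
      ext i
      fin_cases i <;> simp [f1, f2, f3]
    have key : x ⬝ᵥ ((Matrix.of ![![r + q ^ 2 / 2 + M * (p * q) ^ 2, q / 2 + M * p ^ 2 * q,
          -(M * p * q)], ![q / 2 + M * p ^ 2 * q, 1 + M * p ^ 2, -(M * p)],
          ![-(M * p * q), -(M * p), M]] : Matrix (Fin 3) (Fin 3) ℝ) *ᵥ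
          ![x 1, -(p * q + r) * x 0 + -(p + q) * x 1 + x 2, -(p * r) * x 0])
        = (-q * x 1 ^ 2 - q * r * x 0 ^ 2 + (2 * x 1 + q * x 0) * v) / 2 - M * p * v ^ 2 := by
      simp [dotProduct, Matrix.mulVec, Fin.sum_univ_three, hv]
      ring
    have key2 : q / 2 * (x 1 - 2 / q * v) ^ 2 + q * r / 2 * (x 0 - v / r) ^ 2
        = q / 2 * x 1 ^ 2 + q * r / 2 * x 0 ^ 2 - (2 * x 1 + q * x 0) * v
          + (2 / q + q / (2 * r)) * v ^ 2 := by
      field_simp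
      ring
    rw [key]
    rw [key2, ← hMp] at hV
    nlinarith [hV]

/-- A jointly continuous family of homogeneous norms dominates the coordinates, uniformly for
small degrees. -/
lemma exists_coord_bound (H : ℝ → (Fin 2 → ℝ) → ℝ)
    (hHcont : ContinuousOn (Function.uncurry H)
      ((Set.Ioo (-(1:ℝ)/2) (1/2)) ×ˢ (Set.univ : Set (Fin 2 → ℝ))))
    (hHnorm : ∀ μ ∈ Set.Ioo (-(1:ℝ)/2) (1/2), IsHomNorm2 (dmu μ) (H μ)) :
    ∃ C : ℝ, 0 ≤ C ∧ ∀ μ ∈ Set.Icc (-(1:ℝ)/4) (1/4), ∀ ξ : Fin 2 → ℝ,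
      |ξ 0| ≤ C * H μ ξ ^ (1 - μ) ∧ |ξ 1| ≤ C * H μ ξ ^ (1 : ℝ) := by
  have hsub : Set.Icc (-(1:ℝ)/4) (1/4) ⊆ Set.Ioo (-(1:ℝ)/2) (1/2) := fun μ hμ =>
    ⟨by linarith [hμ.1], by linarith [hμ.2]⟩
  have hK : IsCompact (Set.Icc (-(1:ℝ)/4) (1/4) ×ˢ Metric.sphere (0 : Fin 2 → ℝ) 1) :=
    isCompact_Icc.prod (isCompact_sphere _ _)
  obtain ⟨p₀, hp₀, hmin⟩ := hK.exists_isMinOn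
    (Set.Nonempty.prod ⟨0, by norm_num⟩ (NormedSpace.sphere_nonempty.2 zero_le_one))
    (hHcont.mono (Set.prod_mono hsub (Set.subset_univ _)))
  have hc₀ : 0 < H p₀.1 p₀.2 := (hHnorm _ (hsub hp₀.1)).2.2.2.1 _ (by
    rintro h0
    have := hp₀.2
    simp [h0] at this)
  obtain ⟨c, hc, hc1, hcH⟩ : ∃ c : ℝ, 0 < c ∧ c ≤ 1 ∧
      ∀ μ ∈ Set.Icc (-(1:ℝ)/4) (1/4), ∀ ξ : Fin 2 → ℝ, ‖ξ‖ = 1 → c ≤ H μ ξ := by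
    refine ⟨min 1 (H p₀.1 p₀.2), lt_min one_pos hc₀, min_le_left _ _, fun μ hμ ξ hξ => ?_⟩
    exact (min_le_right _ _).trans
      (hmin (show (μ, ξ) ∈ _ from ⟨hμ, by simpa using hξ⟩))
  refine ⟨(1 / c) ^ 2, by positivity, fun μ hμ ξ => ?_⟩
  have hc1' : 1 ≤ 1 / c := by rw [le_div_iff₀ hc]; linarith
  have hμ1 : 0 < 1 - μ := by linarith [hμ.2]
  obtain ⟨-, hnn, h0, -, hhom, -⟩ := hHnorm μ (hsub hμ)
  by_cases hξ : ξ = 0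
  · subst hξ
    simp only [Pi.zero_apply, abs_zero]
    exact ⟨mul_nonneg (by positivity) (Real.rpow_nonneg (hnn _) _),
      mul_nonneg (by positivity) (Real.rpow_nonneg (hnn _) _)⟩
  set ρ : ℝ := max (|ξ 0| ^ (1 / (1 - μ))) |ξ 1| with hρ
  have hρ0 : 0 ≤ ρ := le_max_of_le_right (abs_nonneg _)
  have hx0 : |ξ 0| ≤ ρ ^ (1 - μ) := by
    calc |ξ 0| = (|ξ 0| ^ (1 / (1 - μ))) ^ (1 - μ) := by
          rw [← Real.rpow_mul (abs_nonneg _), one_div_mul_cancel hμ1.ne', Real.rpow_one]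
      _ ≤ ρ ^ (1 - μ) := by
          gcongr
          exact le_max_left _ _
  have hx1 : |ξ 1| ≤ ρ := le_max_right _ _
  have hρpos : 0 < ρ := by
    refine lt_of_le_of_ne hρ0 fun hz => hξ ?_
    rw [← hz, Real.zero_rpow hμ1.ne'] at hx0
    rw [← hz] at hx1
    ext i
    fin_cases i
    · simpa using hx0
    · simpa using hx1
  set η : Fin 2 → ℝ := dmu μ (-Real.log ρ) *ᵥ ξ with hη
  have hη0 : η 0 = ξ 0 / ρ ^ (1 - μ) := by
    simp only [hη, dmu, Matrix.mulVec_diagonal]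
    rw [Real.rpow_def_of_pos hρpos]
    simp [mul_comm, Real.exp_neg, div_eq_mul_inv]
  have hη1 : η 1 = ξ 1 / ρ := by
    simp only [hη, dmu, Matrix.mulVec_diagonal]
    simp [mul_comm, Real.exp_neg, div_eq_mul_inv, Real.exp_log hρpos]
  have hρμ : 0 < ρ ^ (1 - μ) := Real.rpow_pos_of_pos hρpos _
  have hnorm : ‖η‖ = 1 := by
    apply le_antisymm
    · rw [pi_norm_le_iff_of_nonneg zero_le_one, Fin.forall_fin_two]
      rw [hη0, hη1, Real.norm_eq_abs, Real.norm_eq_abs, abs_div, abs_div, abs_of_pos hρμ,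
        abs_of_pos hρpos]
      exact ⟨(div_le_one hρμ).2 hx0, (div_le_one hρpos).2 hx1⟩
    · rcases max_choice (|ξ 0| ^ (1 / (1 - μ))) |ξ 1| with h | h
      · refine le_trans (le_of_eq ?_) (norm_le_pi_norm η 0)
        rw [hη0, Real.norm_eq_abs, abs_div, abs_of_pos hρμ, eq_div_iff hρμ.ne', one_mul, hρ, h,
          ← Real.rpow_mul (abs_nonneg _), one_div_mul_cancel hμ1.ne', Real.rpow_one]
      · refine le_trans (le_of_eq ?_) (norm_le_pi_norm η 1)
        rw [hη1, Real.norm_eq_abs, abs_div, abs_of_pos hρpos, eq_div_iff hρpos.ne', one_mul, hρ, h]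
  have hle : ρ ≤ 1 / c * H μ ξ := by
    have h1 := hcH μ hμ η hnorm
    rw [hη, hhom, Real.exp_neg, Real.exp_log hρpos] at h1
    rw [div_mul_eq_mul_div, one_mul, le_div_iff₀ hc]
    rw [← div_eq_inv_mul, le_div_iff₀ hρpos] at h1
    linarith
  constructor
  · calc |ξ 0| ≤ ρ ^ (1 - μ) := hx0
      _ ≤ (1 / c * H μ ξ) ^ (1 - μ) := by gcongr
      _ = (1 / c) ^ (1 - μ) * H μ ξ ^ (1 - μ) := Real.mul_rpow (by positivity) (hnn _)
      _ ≤ (1 / c) ^ 2 * H μ ξ ^ (1 - μ) := by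
          have := Real.rpow_nonneg (hnn ξ) (1 - μ)
          gcongr
          rw [← Real.rpow_natCast]
          exact Real.rpow_le_rpow_of_exponent_le hc1' (by push_cast; linarith [hμ.1])
  · rw [Real.rpow_one]
    calc |ξ 1| ≤ 1 / c * H μ ξ := hx1.trans hle
      _ ≤ (1 / c) ^ 2 * H μ ξ := by
          have := hnn ξ
          gcongr
          nlinarith

lemma continuousAt_rpow_mul_coord (H : ℝ → (Fin 2 → ℝ) → ℝ)
    (hHcont : ContinuousOn (Function.uncurry H)
      ((Set.Ioo (-(1:ℝ)/2) (1/2)) ×ˢ (Set.univ : Set (Fin 2 → ℝ))))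
    (hHnorm : ∀ μ ∈ Set.Ioo (-(1:ℝ)/2) (1/2), IsHomNorm2 (dmu μ) (H μ))
    {C : ℝ} (hC : 0 ≤ C) {i : Fin 2} {a : ℝ → ℝ} (ha : ContinuousAt a 0) (ha0 : a 0 = 1)
    (hbound : ∀ μ ∈ Set.Icc (-(1:ℝ)/4) (1/4), ∀ ξ : Fin 2 → ℝ, |ξ i| ≤ C * H μ ξ ^ a μ)
    (k : ℝ) (ξ : Fin 2 → ℝ) :
    ContinuousAt (fun p : ℝ × (Fin 2 → ℝ) => H p.1 p.2 ^ (k * p.1) * p.2 i) (0, ξ) := by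
  have hH : ContinuousAt (fun p : ℝ × (Fin 2 → ℝ) => H p.1 p.2) (0, ξ) :=
    hHcont.continuousAt (prod_mem_nhds (Ioo_mem_nhds (by norm_num) (by norm_num)) univ_mem)
  have h0mem : (0 : ℝ) ∈ Set.Ioo (-(1:ℝ)/2) (1/2) := by norm_num
  have hcoord : ContinuousAt (fun p : ℝ × (Fin 2 → ℝ) => p.2 i) (0, ξ) := by fun_prop
  have hexp : ContinuousAt (fun p : ℝ × (Fin 2 → ℝ) => k * p.1) (0, ξ) := by fun_prop
  by_cases hξ : ξ = 0
  · subst hξ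
    have hH0 : H 0 0 = 0 := (hHnorm 0 h0mem).2.2.1
    have ha' : ContinuousAt (fun p : ℝ × (Fin 2 → ℝ) => a p.1) (0, 0) :=
      ContinuousAt.comp (f := Prod.fst) (g := a) ha continuousAt_fst
    have hlim : ContinuousAt
        (fun p : ℝ × (Fin 2 → ℝ) => C * H p.1 p.2 ^ (k * p.1 + a p.1)) (0, 0) :=
      continuousAt_const.mul (hH.rpow (hexp.add ha') (Or.inr (by simp [ha0])))
    have hval : C * H (0, (0 : Fin 2 → ℝ)).1 (0, (0 : Fin 2 → ℝ)).2 ^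
        (k * (0, (0 : Fin 2 → ℝ)).1 + a (0, (0 : Fin 2 → ℝ)).1) = 0 := by
      simp [hH0, ha0]
    rw [ContinuousAt, hval] at hlim
    rw [ContinuousAt]
    simp only [Pi.zero_apply, mul_zero]
    refine squeeze_zero_norm' ?_ hlim
    have hmem : Set.Icc (-(1:ℝ)/4) (1/4) ×ˢ (Set.univ : Set (Fin 2 → ℝ)) ∈
        nhds ((0 : ℝ), (0 : Fin 2 → ℝ)) :=
      prod_mem_nhds (Icc_mem_nhds (by norm_num) (by norm_num)) univ_mem
    filter_upwards [hmem] with p hp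
    obtain ⟨-, hnn, -, hpos, -⟩ := hHnorm p.1 ⟨by linarith [hp.1.1], by linarith [hp.1.2]⟩
    by_cases hz : p.2 = 0
    · rw [hz]
      simpa using mul_nonneg hC (Real.rpow_nonneg (hnn 0) _)
    · have hb := hbound p.1 hp.1 p.2
      have hh := hpos _ hz
      rw [Real.rpow_add hh, norm_mul, Real.norm_eq_abs, Real.norm_eq_abs,
        abs_of_nonneg (Real.rpow_nonneg hh.le _)]
      calc H p.1 p.2 ^ (k * p.1) * |p.2 i|
          ≤ H p.1 p.2 ^ (k * p.1) * (C * H p.1 p.2 ^ a p.1) :=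
            mul_le_mul_of_nonneg_left hb (Real.rpow_nonneg hh.le _)
        _ = _ := by ring
  · exact (hH.rpow hexp (Or.inl ((hHnorm 0 h0mem).2.2.2.1 ξ hξ).ne')).mul hcoord

/-- Joint continuity of the closed-loop vector field at degree zero. -/
lemma continuousAt_gmu (Kp Kd Ki : ℝ) (H : ℝ → (Fin 2 → ℝ) → ℝ)
    (hHcont : ContinuousOn (Function.uncurry H)
      ((Set.Ioo (-(1:ℝ)/2) (1/2)) ×ˢ (Set.univ : Set (Fin 2 → ℝ))))
    (hHnorm : ∀ μ ∈ Set.Ioo (-(1:ℝ)/2) (1/2), IsHomNorm2 (dmu μ) (H μ)) (x : Fin 3 → ℝ) :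
    ContinuousAt (fun p : ℝ × (Fin 3 → ℝ) => gmu Kp Kd Ki p.1 (H p.1) p.2) (0, x) := by
  obtain ⟨C, hC, hb⟩ := exists_coord_bound H hHcont hHnorm
  have hφ : ContinuousAt (fun p : ℝ × (Fin 3 → ℝ) => (p.1, ![p.2 0, p.2 1])) (0, x) := by
    fun_prop
  have h0 : ∀ k : ℝ, ContinuousAt
      (fun p : ℝ × (Fin 3 → ℝ) => H p.1 ![p.2 0, p.2 1] ^ (k * p.1) * p.2 0) (0, x) := fun k =>
    ContinuousAt.comp (f := fun p : ℝ × (Fin 3 → ℝ) => (p.1, ![p.2 0, p.2 1]))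
      (g := fun p : ℝ × (Fin 2 → ℝ) => H p.1 p.2 ^ (k * p.1) * p.2 0)
      (continuousAt_rpow_mul_coord H hHcont hHnorm hC (i := 0)
      (a := fun μ => 1 - μ) (by fun_prop) (by simp) (fun μ hμ ξ => (hb μ hμ ξ).1) k _) hφ
  have h1 : ∀ k : ℝ, ContinuousAt
      (fun p : ℝ × (Fin 3 → ℝ) => H p.1 ![p.2 0, p.2 1] ^ (k * p.1) * p.2 1) (0, x) := fun k =>
    ContinuousAt.comp (f := fun p : ℝ × (Fin 3 → ℝ) => (p.1, ![p.2 0, p.2 1]))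
      (g := fun p : ℝ × (Fin 2 → ℝ) => H p.1 p.2 ^ (k * p.1) * p.2 1)
      (continuousAt_rpow_mul_coord H hHcont hHnorm hC (i := 1)
      (a := fun _ => 1) (by fun_prop) (by simp) (fun μ hμ ξ => (hb μ hμ ξ).2) k _) hφ
  have h11 := h1 1
  simp only [one_mul] at h11
  rw [continuousAt_pi]
  intro i
  fin_cases i
  · simp only [gmu]
    change ContinuousAt (fun p : ℝ × (Fin 3 → ℝ) => p.2 1) (0, x)
    fun_prop
  · have h2 : ContinuousAt (fun p : ℝ × (Fin 3 → ℝ) => p.2 2) (0, x) := by fun_prop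
    refine (((h0 2).const_mul Kp |>.add (h11.const_mul Kd)).add h2).congr (.of_forall fun p => ?_)
    simp [gmu, mul_assoc]
  · refine ((h0 3).const_mul Ki).congr (.of_forall fun p => ?_)
    simp [gmu, mul_assoc]

/-- Weights of the dilation of `ℝ³` for which the closed loop is homogeneous of degree `μ`. -/
def dilWeight (μ : ℝ) : Fin 3 → ℝ := ![1 - μ, 1, 1 + μ]

/-- The dilation of `ℝ³` with weights `dilWeight μ`. -/
noncomputable def dil3 (μ s : ℝ) (x : Fin 3 → ℝ) : Fin 3 → ℝ :=
  fun i => Real.exp (dilWeight μ i * s) * x i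

lemma dil3_dil3_neg (μ s : ℝ) (x : Fin 3 → ℝ) : dil3 μ s (dil3 μ (-s) x) = x := by
  ext i
  simp only [dil3]
  rw [← mul_assoc, ← Real.exp_add, mul_neg, add_neg_cancel, Real.exp_zero, one_mul]

/-- The closed loop is homogeneous of degree `μ`. -/
lemma gmu_dil3 (Kp Kd Ki : ℝ) {μ : ℝ} {h : (Fin 2 → ℝ) → ℝ} (hh : IsHomNorm2 (dmu μ) h)
    (s : ℝ) (y : Fin 3 → ℝ) :
    gmu Kp Kd Ki μ h (dil3 μ s y) = Real.exp (μ * s) • dil3 μ s (gmu Kp Kd Ki μ h y) := by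
  obtain ⟨-, hnn, -, -, hhom, -⟩ := hh
  have hξ : h ![dil3 μ s y 0, dil3 μ s y 1] = Real.exp s * h ![y 0, y 1] := by
    rw [← hhom]
    congr 1
    ext i
    fin_cases i <;> simp [dmu, Matrix.mulVec_diagonal, dil3, dilWeight]
  have hpow : ∀ k : ℝ, (Real.exp s * h ![y 0, y 1]) ^ k
      = Real.exp (k * s) * h ![y 0, y 1] ^ k := fun k => by
    rw [Real.mul_rpow (Real.exp_pos _).le (hnn _), ← Real.exp_mul, mul_comm s]
  have e1 : Real.exp s = Real.exp (μ * s) * Real.exp ((1 - μ) * s) := by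
    rw [← Real.exp_add]; ring_nf
  have e2 : Real.exp (2 * μ * s) * Real.exp ((1 - μ) * s)
      = Real.exp (μ * s) * Real.exp s := by
    rw [← Real.exp_add, ← Real.exp_add]; ring_nf
  have e3 : Real.exp ((1 + μ) * s) = Real.exp (μ * s) * Real.exp s := by
    rw [← Real.exp_add]; ring_nf
  have e4 : Real.exp (3 * μ * s) * Real.exp ((1 - μ) * s)
      = Real.exp (μ * s) * Real.exp ((1 + μ) * s) := by
    rw [← Real.exp_add, ← Real.exp_add]; ring_nf
  ext i
  fin_cases i
  · simp [gmu, dil3, dilWeight]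
    linear_combination y 1 * e1
  · simp only [gmu, hξ, hpow]
    simp [dil3, dilWeight]
    linear_combination Kp * h ![y 0, y 1] ^ (2 * μ) * y 0 * e2 + y 2 * e3
  · simp only [gmu, hξ, hpow]
    simp [dil3, dilWeight]
    linear_combination Ki * h ![y 0, y 1] ^ (3 * μ) * y 0 * e4

lemma HasDerivWithinAt.quadForm {P : Matrix (Fin 3) (Fin 3) ℝ} (hP : P.IsSymm)
    {y : ℝ → Fin 3 → ℝ} {y' : Fin 3 → ℝ} {S : Set ℝ} {t : ℝ} (hy : HasDerivWithinAt y y' S t) :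
    HasDerivWithinAt (fun t => y t ⬝ᵥ P *ᵥ y t) (2 * (y t ⬝ᵥ P *ᵥ y')) S t := by
  have hc := hasDerivWithinAt_pi.1 hy
  have hrow : ∀ i, HasDerivWithinAt (fun t => y t i * ∑ j, P i j * y t j)
      (y' i * (∑ j, P i j * y t j) + y t i * ∑ j, P i j * y' j) S t := fun i =>
    (hc i).mul (HasDerivWithinAt.fun_sum fun j _ => (hc j).const_mul (P i j))
  have hsum := HasDerivWithinAt.fun_sum (u := Finset.univ) fun i _ => hrow i
  refine hsum.congr_deriv ?_
  have h10 : P 1 0 = P 0 1 := hP.apply 0 1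
  have h20 : P 2 0 = P 0 2 := hP.apply 0 2
  have h21 : P 2 1 = P 1 2 := hP.apply 1 2
  simp only [dotProduct, Matrix.mulVec, Fin.sum_univ_three, h10, h20, h21]
  ring

section Decay

variable {Kp Kd Ki μ a b : ℝ} {h : (Fin 2 → ℝ) → ℝ} {P : Matrix (Fin 3) (Fin 3) ℝ}
  {x : ℝ → Fin 3 → ℝ}

/-- The sublevel set of the dilated quadratic form, shrinking at a slow enough rate, confines
the trajectories of the closed loop. -/
lemma dilated_quadForm_le_one (hP : P.IsSymm) (hh : IsHomNorm2 (dmu μ) h)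
    (hneg : ∀ y : Fin 3 → ℝ, y ⬝ᵥ P *ᵥ y = 1 → y ⬝ᵥ P *ᵥ gmu Kp Kd Ki μ h y ≤ -a)
    (hgrow : ∀ y : Fin 3 → ℝ, y ⬝ᵥ P *ᵥ y = 1 → y ⬝ᵥ P *ᵥ (dilWeight μ * y) ≤ b)
    (hx : ∀ t ≥ (0:ℝ), HasDerivWithinAt x (gmu Kp Kd Ki μ h (x t)) (Set.Ici 0) t)
    {c s₀ t₀ T : ℝ} (hc : 0 ≤ c) (ht₀ : 0 ≤ t₀)
    (hrate : ∀ t ∈ Set.Ico t₀ T, c * b < a * Real.exp (μ * (s₀ - c * (t - t₀))))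
    (h₀ : dil3 μ (-s₀) (x t₀) ⬝ᵥ P *ᵥ dil3 μ (-s₀) (x t₀) ≤ 1) :
    ∀ t ∈ Set.Icc t₀ T, dil3 μ (-(s₀ - c * (t - t₀))) (x t) ⬝ᵥ
      P *ᵥ dil3 μ (-(s₀ - c * (t - t₀))) (x t) ≤ 1 := by
  set s : ℝ → ℝ := fun t => s₀ - c * (t - t₀) with hs
  set y : ℝ → Fin 3 → ℝ := fun t => dil3 μ (-(s t)) (x t) with hy
  have hsder : ∀ t, HasDerivAt (fun t => -(s t)) c t := fun t =>
    ((((hasDerivAt_id t).sub_const t₀).const_mul c).const_sub s₀).neg.congr_deriv (by ring)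
  have hyder : ∀ t ≥ (0:ℝ), HasDerivWithinAt y
      (Real.exp (μ * s t) • gmu Kp Kd Ki μ h (y t) + c • (dilWeight μ * y t)) (Set.Ici 0) t := by
    intro t ht
    rw [hasDerivWithinAt_pi]
    intro i
    have hxi := hasDerivWithinAt_pi.1 (hx t ht) i
    have hei : HasDerivWithinAt (fun t => Real.exp (dilWeight μ i * -(s t)))
        (Real.exp (dilWeight μ i * -(s t)) * (dilWeight μ i * c)) (Set.Ici 0) t :=
      (((hsder t).const_mul (dilWeight μ i)).exp).hasDerivWithinAt
    refine (hei.mul hxi).congr_deriv ?_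
    have hxt : x t = dil3 μ (s t) (y t) := (dil3_dil3_neg μ (s t) (x t)).symm
    have hg : gmu Kp Kd Ki μ h (x t) i = Real.exp (μ * s t) *
        (Real.exp (dilWeight μ i * s t) * gmu Kp Kd Ki μ h (y t) i) := by
      rw [hxt, gmu_dil3 Kp Kd Ki hh]
      rfl
    have hinv : Real.exp (dilWeight μ i * -(s t)) * Real.exp (dilWeight μ i * s t) = 1 := by
      rw [← Real.exp_add, mul_neg, neg_add_cancel, Real.exp_zero]
    have hyi : y t i = Real.exp (dilWeight μ i * -(s t)) * x t i := rfl
    simp only [Pi.add_apply, Pi.smul_apply, Pi.mul_apply, smul_eq_mul]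
    rw [hg, hyi]
    linear_combination Real.exp (μ * s t) * gmu Kp Kd Ki μ h (y t) i * hinv
  have hVder : ∀ t ≥ (0:ℝ), HasDerivWithinAt (fun t => y t ⬝ᵥ P *ᵥ y t) _ (Set.Ici 0) t :=
    fun t ht => (hyder t ht).quadForm hP
  intro t ht
  refine image_le_of_deriv_right_lt_deriv_boundary (f := fun t => y t ⬝ᵥ P *ᵥ y t)
    (B := fun _ => 1) (B' := fun _ => 0) ?_
    (fun t ht => (hVder t (ht₀.trans ht.1)).mono (Set.Ici_subset_Ici.2 (ht₀.trans ht.1)))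
    ?_ (fun t => hasDerivAt_const t 1) ?_ ht
  · exact fun t ht => (hVder t (ht₀.trans ht.1)).continuousWithinAt.mono
      fun u hu => ht₀.trans hu.1
  · simpa [hy, hs] using h₀
  · intro t ht hV
    have h1 := hneg _ hV
    have h2 := hgrow _ hV
    have h3 := hrate t ht
    rw [Matrix.mulVec_add, Matrix.mulVec_smul, Matrix.mulVec_smul, dotProduct_add,
      dotProduct_smul, dotProduct_smul, smul_eq_mul, smul_eq_mul]
    have h4 := mul_le_mul_of_nonneg_left h1 (Real.exp_pos (μ * s t)).le
    have h5 := mul_le_mul_of_nonneg_left h2 hc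
    simp only [hs] at h4 ⊢
    linarith

/-- Trajectories stay in every dilated sublevel set that they enter. -/
lemma dilated_quadForm_invariant (ha : 0 < a) (hP : P.IsSymm) (hh : IsHomNorm2 (dmu μ) h)
    (hneg : ∀ y : Fin 3 → ℝ, y ⬝ᵥ P *ᵥ y = 1 → y ⬝ᵥ P *ᵥ gmu Kp Kd Ki μ h y ≤ -a)
    (hgrow : ∀ y : Fin 3 → ℝ, y ⬝ᵥ P *ᵥ y = 1 → y ⬝ᵥ P *ᵥ (dilWeight μ * y) ≤ b)
    (hx : ∀ t ≥ (0:ℝ), HasDerivWithinAt x (gmu Kp Kd Ki μ h (x t)) (Set.Ici 0) t)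
    {s₀ t₀ : ℝ} (ht₀ : 0 ≤ t₀)
    (h₀ : dil3 μ (-s₀) (x t₀) ⬝ᵥ P *ᵥ dil3 μ (-s₀) (x t₀) ≤ 1) :
    ∀ t ≥ t₀, dil3 μ (-s₀) (x t) ⬝ᵥ P *ᵥ dil3 μ (-s₀) (x t) ≤ 1 := by
  intro t ht
  have := dilated_quadForm_le_one hP hh hneg hgrow hx (c := 0) (T := t) le_rfl ht₀
    (fun u _ => by rw [zero_mul]; positivity) h₀ t ⟨ht, le_rfl⟩
  simpa using this

/-- Trajectories eventually enter every dilated sublevel set. -/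
lemma dilated_quadForm_attractive (ha : 0 < a) (hb : 0 < b) (hP : P.IsSymm)
    (hh : IsHomNorm2 (dmu μ) h)
    (hneg : ∀ y : Fin 3 → ℝ, y ⬝ᵥ P *ᵥ y = 1 → y ⬝ᵥ P *ᵥ gmu Kp Kd Ki μ h y ≤ -a)
    (hgrow : ∀ y : Fin 3 → ℝ, y ⬝ᵥ P *ᵥ y = 1 → y ⬝ᵥ P *ᵥ (dilWeight μ * y) ≤ b)
    (hx : ∀ t ≥ (0:ℝ), HasDerivWithinAt x (gmu Kp Kd Ki μ h (x t)) (Set.Ici 0) t)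
    {s₀ s₁ : ℝ} (hs : s₁ ≤ s₀)
    (h₀ : dil3 μ (-s₀) (x 0) ⬝ᵥ P *ᵥ dil3 μ (-s₀) (x 0) ≤ 1) :
    ∀ᶠ t in atTop, dil3 μ (-s₁) (x t) ⬝ᵥ P *ᵥ dil3 μ (-s₁) (x t) ≤ 1 := by
  set m : ℝ := min (Real.exp (μ * s₀)) (Real.exp (μ * s₁)) with hm
  have hmpos : 0 < m := lt_min (Real.exp_pos _) (Real.exp_pos _)
  have hmle : ∀ s ∈ Set.Icc s₁ s₀, m ≤ Real.exp (μ * s) := by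
    intro s hs
    rcases le_total 0 μ with hμ | hμ
    · exact (min_le_right _ _).trans
        (Real.exp_le_exp.2 (mul_le_mul_of_nonneg_left hs.1 hμ))
    · exact (min_le_left _ _).trans
        (Real.exp_le_exp.2 (mul_le_mul_of_nonpos_left hs.2 hμ))
  set c : ℝ := a * m / (2 * b) with hc
  have hcpos : 0 < c := by positivity
  have hcb : c * b = a * m / 2 := by rw [hc]; field_simp
  set T : ℝ := (s₀ - s₁) / c with hT
  have hT0 : 0 ≤ T := div_nonneg (by linarith) hcpos.le
  have hcT : c * T = s₀ - s₁ := by rw [hT]; field_simp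
  have hreach := dilated_quadForm_le_one hP hh hneg hgrow hx (T := T) hcpos.le le_rfl
    (fun t ht => by
      have h1 : c * t ≤ c * T := mul_le_mul_of_nonneg_left ht.2.le hcpos.le
      have h2 : 0 ≤ c * t := mul_nonneg hcpos.le ht.1
      have h3 := hmle (s₀ - c * (t - 0)) ⟨by rw [sub_zero]; linarith, by rw [sub_zero]; linarith⟩
      have h4 := mul_le_mul_of_nonneg_left h3 ha.le
      have h5 : 0 < a * m := mul_pos ha hmpos
      linarith) h₀ T ⟨hT0, le_rfl⟩
  rw [sub_zero, hcT, sub_sub_cancel] at hreach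
  filter_upwards [eventually_ge_atTop T] with t ht
  exact dilated_quadForm_invariant ha hP hh hneg hgrow hx hT0 hreach t ht

end Decay

lemma exists_quadForm_lower_bound {P : Matrix (Fin 3) (Fin 3) ℝ}
    (hpos : ∀ x : Fin 3 → ℝ, x ≠ 0 → 0 < x ⬝ᵥ (P *ᵥ x)) :
    ∃ m > 0, ∀ x : Fin 3 → ℝ, m * ‖x‖ ^ 2 ≤ x ⬝ᵥ (P *ᵥ x) := by
  obtain ⟨y, hy, hmin⟩ := (isCompact_sphere (0 : Fin 3 → ℝ) 1).exists_isMinOn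
    (NormedSpace.sphere_nonempty.2 zero_le_one)
    (f := fun x : Fin 3 → ℝ => x ⬝ᵥ (P *ᵥ x)) (by fun_prop)
  have hy0 : y ≠ 0 := by
    rintro rfl
    simp at hy
  refine ⟨_, hpos y hy0, fun x => ?_⟩
  by_cases hx : x = 0
  · simp [hx]
  have hn : 0 < ‖x‖ := norm_pos_iff.2 hx
  have h1 := hmin (show ‖x‖⁻¹ • x ∈ Metric.sphere (0 : Fin 3 → ℝ) 1 by
    simp [norm_smul, hn.ne'])
  simp only [Set.mem_ofPred_eq, Matrix.mulVec_smul, dotProduct_smul, smul_dotProduct,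
    smul_eq_mul] at h1
  calc _ ≤ ‖x‖⁻¹ * (‖x‖⁻¹ * (x ⬝ᵥ (P *ᵥ x))) * ‖x‖ ^ 2 := by gcongr
    _ = _ := by field_simp

lemma abs_le_eucNorm3 (x : Fin 3 → ℝ) (i : Fin 3) : |x i| ≤ eucNorm3 x :=
  Real.abs_le_sqrt (Finset.single_le_sum (f := fun i => x i ^ 2)
    (fun j _ => sq_nonneg (x j)) (Finset.mem_univ i))

lemma eucNorm3_le_of_norm_le {x : Fin 3 → ℝ} {r : ℝ} (hr : 0 ≤ r) (hx : ‖x‖ ≤ r / 2) :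
    eucNorm3 x ≤ r := by
  refine Real.sqrt_le_iff.2 ⟨hr, ?_⟩
  have h : ∀ i, x i ^ 2 ≤ (r / 2) ^ 2 := fun i =>
    sq_le_sq' (abs_le.1 ((norm_le_pi_norm x i).trans hx)).1
      (abs_le.1 ((norm_le_pi_norm x i).trans hx)).2
  rw [Fin.sum_univ_three]
  nlinarith [h 0, h 1, h 2]

lemma dilWeight_pos {μ : ℝ} (hμ : |μ| < 1) (i : Fin 3) : 0 < dilWeight μ i := by
  rw [abs_lt] at hμ
  fin_cases i <;> simp [dilWeight] <;> linarith

lemma tendsto_exp_dilWeight {μ : ℝ} (hμ : |μ| < 1) (i : Fin 3) :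
    Tendsto (fun s => Real.exp (dilWeight μ i * s)) atBot (nhds 0) :=
  Real.tendsto_exp_atBot.comp (tendsto_id.const_mul_atBot (dilWeight_pos hμ i))

/-- Strongly contracted sublevel sets of the quadratic form are small. -/
lemma eventually_norm_le_of_dilated_quadForm_le {P : Matrix (Fin 3) (Fin 3) ℝ} {m μ η : ℝ}
    (hm : 0 < m) (hlow : ∀ x : Fin 3 → ℝ, m * ‖x‖ ^ 2 ≤ x ⬝ᵥ (P *ᵥ x)) (hμ : |μ| < 1)
    (hη : 0 < η) :
    ∀ᶠ s in atBot, ∀ x : Fin 3 → ℝ,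
      dil3 μ (-s) x ⬝ᵥ (P *ᵥ dil3 μ (-s) x) ≤ 1 → ‖x‖ ≤ η := by
  set R : ℝ := Real.sqrt (1 / m) with hR
  have hev : ∀ i, ∀ᶠ s in atBot, Real.exp (dilWeight μ i * s) * R < η := fun i => by
    have := (tendsto_exp_dilWeight hμ i).mul_const R
    rw [zero_mul] at this
    exact this.eventually_lt_const hη
  filter_upwards [eventually_all.2 hev] with s hs x hx
  have hy : ‖dil3 μ (-s) x‖ ≤ R := by
    refine Real.le_sqrt_of_sq_le ?_
    rw [le_div_iff₀ hm, mul_comm]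
    exact (hlow _).trans hx
  rw [pi_norm_le_iff_of_nonneg hη.le]
  intro i
  rw [← dil3_dil3_neg μ s x]
  calc ‖dil3 μ s (dil3 μ (-s) x) i‖
      = Real.exp (dilWeight μ i * s) * ‖dil3 μ (-s) x i‖ := by
        rw [dil3, norm_mul, Real.norm_eq_abs, Real.abs_exp]
    _ ≤ Real.exp (dilWeight μ i * s) * R := by
        gcongr
        exact (norm_le_pi_norm _ i).trans hy
    _ ≤ η := (hs i).le

/-- Theorem 1: if the linear PID closed-loop matrix `A` is Hurwitz, and
`H(μ,·)` is a jointly continuous family of `d_μ`-homogeneous norms, then there is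
`ε ∈ (0, 1/2]` such that for every `|μ| < ε` the hPID closed loop `ẋ = g_μ(x)` is
globally asymptotically stable: (i) Lyapunov stability and (ii) global attractivity. -/
theorem hPID_GAS_near_zero_degree
    (Kp Kd Ki : ℝ)
    (A : Matrix (Fin 3) (Fin 3) ℝ)
    (hA : A = Matrix.of ![![0, 1, 0], ![Kp, Kd, 1], ![Ki, 0, 0]])
    (hHurwitz : ∀ z ∈ spectrum ℂ (A.map (algebraMap ℝ ℂ)), z.re < 0)
    (H : ℝ → (Fin 2 → ℝ) → ℝ)
    (hHcont : ContinuousOn (Function.uncurry H)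
      ((Set.Ioo (-(1:ℝ)/2) (1/2)) ×ˢ (Set.univ : Set (Fin 2 → ℝ))))
    (hHnorm : ∀ μ ∈ Set.Ioo (-(1:ℝ)/2) (1/2), IsHomNorm2 (dmu μ) (H μ)) :
    ∃ ε : ℝ, 0 < ε ∧ ε ≤ 1/2 ∧ ∀ μ : ℝ, |μ| < ε →
      ((∀ r > (0:ℝ), ∃ δ > (0:ℝ), ∀ x : ℝ → (Fin 3 → ℝ),
          (∀ t ≥ (0:ℝ), HasDerivWithinAt x (gmu Kp Kd Ki μ (H μ) (x t)) (Set.Ici 0) t) →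
          eucNorm3 (x 0) ≤ δ → ∀ t ≥ (0:ℝ), eucNorm3 (x t) ≤ r) ∧
       (∀ x : ℝ → (Fin 3 → ℝ),
          (∀ t ≥ (0:ℝ), HasDerivWithinAt x (gmu Kp Kd Ki μ (H μ) (x t)) (Set.Ici 0) t) →
          Tendsto x atTop (nhds 0))) := by
  
  subst hA
  obtain ⟨P, hP, hpos, hdec⟩ := exists_lyapunov_matrix Kp Kd Ki hHurwitz
  obtain ⟨m, hm, hlow⟩ := exists_quadForm_lower_bound hpos
  set S : Set (Fin 3 → ℝ) := {y | y ⬝ᵥ (P *ᵥ y) = 1} with hS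
  have hScpt : IsCompact S := by
    refine Metric.isCompact_of_isClosed_isBounded
      (isClosed_eq (by fun_prop) continuous_const) ?_
    refine (Metric.isBounded_closedBall (x := (0 : Fin 3 → ℝ)) (r := Real.sqrt (1 / m))).subset ?_
    intro y hy
    rw [mem_closedBall_zero_iff]
    refine Real.le_sqrt_of_sq_le ?_
    rw [le_div_iff₀ hm, mul_comm]
    exact (hlow y).trans (le_of_eq hy)
  have hS0 : ∀ y ∈ S, y ≠ 0 := by
    rintro y hy rfl
    simp [hS] at hy
  obtain ⟨a, ha, hSa⟩ : ∃ a > 0, ∀ y ∈ S,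
      y ⬝ᵥ (P *ᵥ ![y 1, Kp * y 0 + Kd * y 1 + y 2, Ki * y 0]) < -a := by
    have hcont : Continuous fun y : Fin 3 → ℝ =>
      y ⬝ᵥ (P *ᵥ ![y 1, Kp * y 0 + Kd * y 1 + y 2, Ki * y 0]) := by fun_prop
    rcases S.eq_empty_or_nonempty with he | hne
    · exact ⟨1, one_pos, by simp [he]⟩
    obtain ⟨y₀, hy₀, hmax⟩ := hScpt.exists_isMaxOn hne hcont.continuousOn
    have h0 := hdec y₀ (hS0 y₀ hy₀)
    exact ⟨-(y₀ ⬝ᵥ (P *ᵥ ![y₀ 1, Kp * y₀ 0 + Kd * y₀ 1 + y₀ 2, Ki * y₀ 0])) / 2, by linarith,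
      fun y hy => lt_of_le_of_lt (hmax hy) (by linarith)⟩
  have hev : ∀ᶠ μ in nhds (0 : ℝ), ∀ y ∈ S, y ⬝ᵥ (P *ᵥ gmu Kp Kd Ki μ (H μ) y) < -a := by
    refine hScpt.eventually_forall_of_forall_eventually fun y hy => ?_
    have hg := continuousAt_gmu Kp Kd Ki H hHcont hHnorm y
    have hq : ContinuousAt (fun p : ℝ × (Fin 3 → ℝ) =>
        p.2 ⬝ᵥ (P *ᵥ gmu Kp Kd Ki p.1 (H p.1) p.2)) (0, y) := by
      have hbil : Continuous fun q : (Fin 3 → ℝ) × (Fin 3 → ℝ) => q.1 ⬝ᵥ (P *ᵥ q.2) := by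
        fun_prop
      exact hbil.continuousAt.comp (continuousAt_snd.prodMk hg)
    refine hq.eventually_lt_const ?_
    simpa [gmu] using hSa y hy
  obtain ⟨ε, hε, hball⟩ := Metric.eventually_nhds_iff.1 hev
  refine ⟨min ε (1 / 2), by positivity, min_le_right _ _, fun μ hμ => ?_⟩
  have hμ2 : |μ| < 1 / 2 := hμ.trans_le (min_le_right _ _)
  have hμ1 : |μ| < 1 := by linarith
  have hh : IsHomNorm2 (dmu μ) (H μ) :=
    hHnorm μ ⟨by linarith [(abs_lt.1 hμ2).1], (abs_lt.1 hμ2).2⟩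
  have hneg : ∀ y : Fin 3 → ℝ, y ⬝ᵥ (P *ᵥ y) = 1 →
      y ⬝ᵥ (P *ᵥ gmu Kp Kd Ki μ (H μ) y) ≤ -a := fun y hy =>
    (hball (by simpa using hμ.trans_le (min_le_left _ _)) y hy).le
  obtain ⟨b, hb, hgrow⟩ : ∃ b > 0, ∀ y : Fin 3 → ℝ, y ⬝ᵥ (P *ᵥ y) = 1 →
      y ⬝ᵥ (P *ᵥ (dilWeight μ * y)) ≤ b := by
    obtain ⟨b, hb⟩ := hScpt.bddAbove_image (f := fun y => y ⬝ᵥ (P *ᵥ (dilWeight μ * y)))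
      (by fun_prop)
    exact ⟨max b 1, by positivity, fun y hy =>
      (hb (Set.mem_image_of_mem _ hy)).trans (le_max_left _ _)⟩
  constructor
  · intro r hr
    obtain ⟨s, hs⟩ := (eventually_norm_le_of_dilated_quadForm_le hm hlow hμ1 (half_pos hr)).exists
    have hcont : Continuous fun x : Fin 3 → ℝ => dil3 μ (-s) x ⬝ᵥ (P *ᵥ dil3 μ (-s) x) := by
      unfold dil3
      fun_prop
    have hnear : ∀ᶠ x in nhds (0 : Fin 3 → ℝ),
        dil3 μ (-s) x ⬝ᵥ (P *ᵥ dil3 μ (-s) x) < 1 :=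
      hcont.continuousAt.eventually_lt_const (by simp [dil3, dotProduct])
    obtain ⟨δ, hδ, hδball⟩ := Metric.eventually_nhds_iff.1 hnear
    refine ⟨δ / 2, half_pos hδ, fun x hx hx0 t ht => ?_⟩
    have hnorm : ‖x 0‖ ≤ δ / 2 :=
      (pi_norm_le_iff_of_nonneg (half_pos hδ).le).2 fun i =>
        (abs_le_eucNorm3 (x 0) i).trans hx0
    have h0 := (hδball (y := x 0) (by rw [dist_zero_right]; linarith)).le
    exact eucNorm3_le_of_norm_le hr.le
      (hs _ (dilated_quadForm_invariant ha hP hh hneg hgrow hx le_rfl h0 t ht))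
  · intro x hx
    obtain ⟨s₀, hs₀⟩ : ∃ s₀, dil3 μ (-s₀) (x 0) ⬝ᵥ (P *ᵥ dil3 μ (-s₀) (x 0)) ≤ 1 := by
      have hlim : Tendsto (fun s => dil3 μ s (x 0)) atBot (nhds 0) := by
        rw [tendsto_pi_nhds]
        intro i
        simpa [dil3] using (tendsto_exp_dilWeight hμ1 i).mul_const (x 0 i)
      have hq : Continuous fun y : Fin 3 → ℝ => y ⬝ᵥ (P *ᵥ y) := by fun_prop
      obtain ⟨s, hs⟩ := (((hq.tendsto 0).comp hlim).eventually_lt_const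
        (show (0 : Fin 3 → ℝ) ⬝ᵥ (P *ᵥ 0) < 1 by simp)).exists
      exact ⟨-s, by simpa using hs.le⟩
    rw [Metric.tendsto_nhds]
    intro η hη
    obtain ⟨s₁, hs₁, hle⟩ := ((eventually_norm_le_of_dilated_quadForm_le hm hlow hμ1
      (half_pos hη)).and (eventually_le_atBot s₀)).exists
    filter_upwards [dilated_quadForm_attractive ha hb hP hh hneg hgrow hx hle hs₀] with t ht
    rw [dist_zero_right]
    linarith [hs₁ _ ht]
end
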